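/- Let α be a finite type with Fintype.card α ≤ 2^w, and let r be a binary relation on α. Define R₀ a b := (a = b ∨ r a b) and let Sq be the squaring operator Sq R := Relation.Comp R R. Then the w-fold iterate Sq^[w] R₀ coincides with ReflTransGen r, i.e., for all a b, (Sq^[w] R₀) a b ↔ ReflTransGen r a b. -/

import Mathlib

theorem Relation.iterate_comp_self_of_forall_step {α : Type*} {R : α → α → Prop} {f : ℕ → α}
    (hf : ∀ i, R (f i) (f (i + 1))) (w k : ℕ) :
    ((fun R : α → α → Prop => Relation.Comp R R)^[w] R) (f k) (f (k + 2 ^ w)) := by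
  induction w generalizing k with
  | zero => simpa using hf k
  | succ w ih =>
    rw [Function.iterate_succ_apply']
    refine ⟨f (k + 2 ^ w), ih k, ?_⟩
    have h := ih (k + 2 ^ w)
    rwa [add_assoc, ← two_mul, ← pow_succ'] at h

theorem Relation.reflTransGen_of_iterate_comp_self {α : Type*} {R r : α → α → Prop}
    (hR : ∀ a b, R a b → Relation.ReflTransGen r a b) (w : ℕ) {a b : α}
    (h : ((fun R : α → α → Prop => Relation.Comp R R)^[w] R) a b) :
    Relation.ReflTransGen r a b := by
  induction w generalizing a b with
  | zero => exact hR a b h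
  | succ w ih =>
    rw [Function.iterate_succ_apply'] at h
    obtain ⟨c, hac, hcb⟩ := h
    exact (ih hac).trans (ih hcb)

theorem Relation.ReflTransGen.exists_seq {α : Type*} {r : α → α → Prop} {a b : α}
    (h : Relation.ReflTransGen r a b) :
    ∃ (n : ℕ) (f : ℕ → α), f 0 = a ∧ f n = b ∧ ∀ i < n, r (f i) (f (i + 1)) := by
  induction h with
  | refl => exact ⟨0, fun _ => a, rfl, rfl, by simp⟩
  | @tail b c _ hbc ih =>
    obtain ⟨n, f, h0, hn, hf⟩ := ih
    refine ⟨n + 1, fun k => if k ≤ n then f k else c, by simpa using h0, by simp, ?_⟩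
    intro i hi
    rcases Nat.lt_succ_iff_lt_or_eq.mp hi with hi' | rfl
    · simpa [hi'.le, Nat.succ_le_iff.mpr hi'] using hf i hi'
    · simpa [hn] using hbc

/-- A shortest path visits no vertex twice, so its length is less than the number of vertices. -/
theorem Relation.ReflTransGen.exists_seq_lt_card {α : Type*} [Fintype α] {r : α → α → Prop}
    {a b : α} (h : Relation.ReflTransGen r a b) :
    ∃ n < Fintype.card α, ∃ f : ℕ → α,
      f 0 = a ∧ f n = b ∧ ∀ i < n, r (f i) (f (i + 1)) := by
  classical
  have hex := h.exists_seq
  obtain ⟨f, h0, hn, hf⟩ := Nat.find_spec hex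
  set n := Nat.find hex
  refine ⟨n, ?_, f, h0, hn, hf⟩
  have hne : ∀ i j, i < j → j ≤ n → f i ≠ f j := by
    intro i j hij hj heq
    refine Nat.find_min hex (m := n - (j - i)) (by omega)
      ⟨fun k => if k ≤ i then f k else f (k + (j - i)), by simpa using h0, ?_, ?_⟩
    · by_cases hle : n - (j - i) ≤ i
      · obtain rfl : j = n := by omega
        have hi : n - (n - i) = i := by omega
        simp only [hi, le_refl, if_true, heq, hn]
      · simp only [hle, if_false]
        rw [Nat.sub_add_cancel (by omega), hn]
    · intro k hk
      rcases lt_trichotomy k i with hki | rfl | hki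
      · simpa [hki.le, Nat.succ_le_iff.mpr hki] using hf k (by omega)
      · have hkj : k + 1 + (j - k) = j + 1 := by omega
        simpa [hkj, heq] using hf j (by omega)
      · have hk1 : k + 1 + (j - i) = k + (j - i) + 1 := by omega
        simpa [hki.not_ge, (Nat.lt_succ_of_lt hki).not_ge, hk1] using
          hf (k + (j - i)) (by omega)
  have hinj : Function.Injective fun i : Fin (n + 1) => f i := by
    intro i j hij
    rcases lt_trichotomy i j with hlt | heq | hlt
    · exact absurd hij (hne i j hlt (by omega))
    · exact heq
    · exact absurd hij.symm (hne j i hlt (by omega))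
  simpa using Fintype.card_le_of_injective _ hinj

theorem stmt5 {w : ℕ} {α : Type*} [Fintype α] (hcard : Fintype.card α ≤ 2 ^ w)
    (r : α → α → Prop) :
    ∀ a b : α,
      ((fun R : α → α → Prop => Relation.Comp R R)^[w] (fun a b => a = b ∨ r a b)) a b ↔
        Relation.ReflTransGen r a b := by
  intro a b
  constructor
  · refine Relation.reflTransGen_of_iterate_comp_self ?_ w
    rintro a b (rfl | hab)
    · exact .refl
    · exact .single hab
  · intro h
    obtain ⟨n, hn, f, rfl, rfl, hf⟩ := h.exists_seq_lt_card
    have hstep : ∀ i, f (min i n) = f (min (i + 1) n) ∨ r (f (min i n)) (f (min (i + 1) n)) := by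
      intro i
      rcases lt_or_ge i n with hi | hi
      · right
        simpa [hi.le, Nat.succ_le_iff.mpr hi] using hf i hi
      · left
        rw [min_eq_right hi, min_eq_right (by omega)]
    have hpath := Relation.iterate_comp_self_of_forall_step
      (R := fun a b => a = b ∨ r a b) (f := fun i => f (min i n)) hstep w 0
    simpa [min_eq_right (hn.le.trans hcard)] using hpath
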